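/- Let G = K₆ − e be the complete graph on 6 vertices with one edge removed (so G has 6 vertices and 14 = 3·6 − 4 edges). Then there exists a placement q ∈ Σ^V of G in Σ such that the framework (G,q) is full in Σ and infinitesimally rigid; thus K₆ − e is (minimally) rigid in the hypercylinder Σ. -/

import Mathlib

open Matrix BigOperators

/-- The hypercylinder Σ in ℝ⁴. -/
def Hyp : Set (Fin 4 → ℝ) := {x | x 0 ^ 2 + x 1 ^ 2 + x 2 ^ 2 = 1}

/-- π(x)·π(y), where π : ℝ⁴ → ℝ³ drops the last coordinate. -/
def piDot (x y : Fin 4 → ℝ) : ℝ := x 0 * y 0 + x 1 * y 1 + x 2 * y 2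

/-- The Euclidean inner product on ℝ⁴. -/
def dot4 (x y : Fin 4 → ℝ) : ℝ := ∑ i, x i * y i

/-- The pair (B,c) determines an infinitesimal rigid motion η(x) = Bx + c of Σ. -/
def InTSigma (B : Matrix (Fin 4) (Fin 4) ℝ) (c : Fin 4 → ℝ) : Prop :=
  Bᵀ = -B ∧ ∀ x ∈ Hyp, piDot (B.mulVec x + c) x = 0

/-- m is an infinitesimal flex of the framework (G,q) in Σ. -/
def IsFlex {V : Type*} (G : SimpleGraph V) (q m : V → Fin 4 → ℝ) : Prop :=
  (∀ u v, G.Adj u v → dot4 (m u - m v) (q u - q v) = 0) ∧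
    (∀ v, piDot (m v) (q v) = 0)

/-- The framework (G,q) is full in Σ. -/
def Full {V : Type*} (G : SimpleGraph V) (q : V → Fin 4 → ℝ) : Prop :=
  ∀ (B : Matrix (Fin 4) (Fin 4) ℝ) (c : Fin 4 → ℝ), InTSigma B c →
    (∀ v, B.mulVec (q v) + c = 0) → B = 0 ∧ c = 0

/-- The framework (G,q) is infinitesimally rigid in Σ. -/
def InfRigid {V : Type*} (G : SimpleGraph V) (q : V → Fin 4 → ℝ) : Prop :=
  ∀ m : V → Fin 4 → ℝ, IsFlex G q m →
    ∃ (B : Matrix (Fin 4) (Fin 4) ℝ) (c : Fin 4 → ℝ), InTSigma B c ∧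
      ∀ v, m v = B.mulVec (q v) + c

/-- The graph K₆ − e: the complete graph on 6 vertices with the edge between
vertices 4 and 5 removed. -/
def K6e : SimpleGraph (Fin 6) :=
  (⊤ : SimpleGraph (Fin 6)).deleteEdges {s(4, 5)}

/-- The placement of the six vertices at `e₁`, `-e₃ + e₄`, `e₃`, `e₂ + e₄`, `e₂`, `e₁ + e₄`. -/
def placement : Fin 6 → Fin 4 → ℝ :=
  ![![1, 0, 0, 0], ![0, 0, -1, 1], ![0, 0, 1, 0], ![0, 1, 0, 1], ![0, 1, 0, 0], ![1, 0, 0, 1]]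

theorem K6e_adj_iff (u v : Fin 6) : K6e.Adj u v ↔ u ≠ v ∧ s(u, v) ≠ s(4, 5) := by
  simp [K6e]

theorem ncard_edgeSet_K6e : K6e.edgeSet.ncard = 14 := by
  have h : K6e.edgeSet =
      ↑(Finset.univ.filter fun e : Sym2 (Fin 6) => ¬ e.IsDiag ∧ e ≠ s(4, 5)) := by
    ext e
    induction e with
    | h u v => simp [K6e_adj_iff]
  rw [h, Set.ncard_coe_finset]
  decide

theorem placement_mem_hyp (v : Fin 6) : placement v ∈ Hyp := by
  fin_cases v <;> simp [placement, Hyp]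

theorem full_placement : Full K6e placement := by
  intro B c _ h
  have row : ∀ i, (∀ j, B i j = 0) ∧ c i = 0 := by
    intro i
    have h0 := congrFun (h 0) i
    have h1 := congrFun (h 1) i
    have h2 := congrFun (h 2) i
    have h4 := congrFun (h 4) i
    have h5 := congrFun (h 5) i
    simp [placement, Matrix.mulVec, dotProduct, Fin.sum_univ_four] at h0 h1 h2 h4 h5
    refine ⟨fun j => ?_, by linarith⟩
    fin_cases j <;> simp only [Fin.zero_eta, Fin.mk_one, Fin.reduceFinMk] <;> linarith
  exact ⟨Matrix.ext fun i j => (row i).1 j, funext fun i => (row i).2⟩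

/-- Rotations of the spherical factor and translations along the axis preserve `Hyp` to first
order. -/
theorem inTSigma_rotation_translation (a b c t : ℝ) :
    InTSigma !![0, a, b, 0; -a, 0, c, 0; -b, -c, 0, 0; 0, 0, 0, 0] ![0, 0, 0, t] := by
  refine ⟨?_, fun x _ => ?_⟩
  · ext i j
    fin_cases i <;> fin_cases j <;> simp
  · simp [piDot, dotProduct, Fin.sum_univ_four]
    ring

theorem infRigid_placement : InfRigid K6e placement := by
  rintro m ⟨hedge, hsurf⟩
  refine ⟨_, _, inTSigma_rotation_translation (-m 0 1) (-m 0 2) (-m 4 2) (m 0 3), ?_⟩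
  have e (u v : Fin 6) (huv : u ≠ v ∧ s(u, v) ≠ s(4, 5)) :=
    hedge u v ((K6e_adj_iff u v).2 huv)
  have e01 := e 0 1 (by decide)
  have e02 := e 0 2 (by decide)
  have e03 := e 0 3 (by decide)
  have e04 := e 0 4 (by decide)
  have e05 := e 0 5 (by decide)
  have e12 := e 1 2 (by decide)
  have e13 := e 1 3 (by decide)
  have e14 := e 1 4 (by decide)
  have e15 := e 1 5 (by decide)
  have e23 := e 2 3 (by decide)
  have e24 := e 2 4 (by decide)
  have e25 := e 2 5 (by decide)
  have e34 := e 3 4 (by decide)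
  have e35 := e 3 5 (by decide)
  have s0 := hsurf 0
  have s1 := hsurf 1
  have s2 := hsurf 2
  have s3 := hsurf 3
  have s4 := hsurf 4
  have s5 := hsurf 5
  clear e hedge hsurf
  simp [placement, dot4, piDot, Fin.sum_univ_four] at *
  intro v
  ext i
  fin_cases v <;> fin_cases i <;>
    simp <;> linarith

theorem stmt6 :
    K6e.edgeSet.ncard = 14 ∧
      ∃ q : Fin 6 → Fin 4 → ℝ, (∀ v, q v ∈ Hyp) ∧ Full K6e q ∧ InfRigid K6e q := by
  exact ⟨ncard_edgeSet_K6e, placement, placement_mem_hyp, full_placement, infRigid_placement⟩
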